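/- arXiv:1311.4442 — 2 statements merged into one kernel-verified Lean document; each statement's English description precedes it below -/
import Mathlib

section
/- Let f : ℝ → ℝ be continuous with compact support, let τ > 0 and β > 0, and let u(τ,x) = (1/(2√(πτ))) ∫_ℝ exp(−(x−ξ)²/(4τ)) f(ξ) dξ. Then for every real x the series (1/√π) · ∑_{j=0}^∞ (1/(2√(τ+β))^{2j+1}) · ((−1)^j β^j / j!) · f_{2j} converges to u(τ,x), where f_{2j} = ∫_ℝ H_{2j}((x−ξ)/(2√β)) f(ξ) dξ. -/
open Real MeasureTheory

/-- The physicists' Hermite polynomial `H_n(z) = (-1)^n e^{z²} (d^n/dz^n) e^{-z²}`. -/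
noncomputable def hermiteH (n : ℕ) (z : ℝ) : ℝ :=
  (-1) ^ n * Real.exp (z ^ 2) * iteratedDeriv n (fun t : ℝ => Real.exp (-t ^ 2)) z

open scoped FourierTransform

theorem integrable_natPow_mul_exp_neg_mul_sq {b : ℝ} (hb : 0 < b) (n : ℕ) :
    Integrable fun x : ℝ => x ^ n * Real.exp (-b * x ^ 2) := by
  have h := integrable_rpow_mul_exp_neg_mul_sq hb (s := n)
    (lt_of_lt_of_le (by norm_num) (Nat.cast_nonneg n))
  simpa only [Real.rpow_natCast] using h

theorem iteratedDeriv_ofReal_comp {f : ℝ → ℝ} (hf : ContDiff ℝ (⊤ : ℕ∞) f) (n : ℕ) :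
    iteratedDeriv n (fun t : ℝ => (f t : ℂ)) = fun t => ((iteratedDeriv n f t : ℝ) : ℂ) := by
  induction n with
  | zero => simp
  | succ n ih =>
    rw [iteratedDeriv_succ, ih, iteratedDeriv_succ]
    funext t
    have hd : Differentiable ℝ (iteratedDeriv n f) :=
      hf.differentiable_iteratedDeriv n (mod_cast ENat.natCast_lt_top n)
    exact ((hd t).hasDerivAt.ofReal_comp).deriv

theorem contDiff_exp_neg_sq : ContDiff ℝ (⊤ : ℕ∞) fun t : ℝ => Real.exp (-t ^ 2) := by
  fun_prop

theorem fourier_gaussian_real {b : ℝ} (hb : 0 < b) (w : ℝ) :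
    𝓕 (fun x : ℝ => (Real.exp (-(π * b) * x ^ 2) : ℂ)) w =
      ((1 / √b * Real.exp (-π / b * w ^ 2) : ℝ) : ℂ) := by
  have h := congrFun (fourier_gaussian_pi (b := (b : ℂ)) (by simpa using hb)) w
  have e : (b : ℂ) ^ (1 / 2 : ℂ) = ((√b : ℝ) : ℂ) := by
    rw [Real.sqrt_eq_rpow, Complex.ofReal_cpow hb.le]
    norm_num
  rw [e] at h
  push_cast
  rw [← h]
  simp only [neg_mul]

theorem ofReal_iteratedDeriv_exp_neg_sq (n : ℕ) (z : ℝ) :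
    ((iteratedDeriv n (fun t : ℝ => Real.exp (-t ^ 2)) z : ℝ) : ℂ) =
      ((√π : ℝ) : ℂ) * ∫ x : ℝ, Complex.exp (((-2 * π * x * z : ℝ) : ℂ) * Complex.I) *
        ((-2 * π * Complex.I * x) ^ n * (Real.exp (-(π * π) * x ^ 2) : ℂ)) := by
  have hpi : ((√π : ℝ) : ℂ) ≠ 0 := by
    exact_mod_cast (Real.sqrt_pos.mpr pi_pos).ne'
  have key : (fun t : ℝ => ((Real.exp (-t ^ 2) : ℝ) : ℂ)) =
      fun t => ((√π : ℝ) : ℂ) * 𝓕 (fun x : ℝ => (Real.exp (-(π * π) * x ^ 2) : ℂ)) t := by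
    funext t
    rw [fourier_gaussian_real pi_pos, neg_div, div_self pi_pos.ne']
    push_cast
    field_simp
  have h := Real.iteratedDeriv_fourier (N := ⊤) (n := n)
    (f := fun x : ℝ => (Real.exp (-(π * π) * x ^ 2) : ℂ))
    (fun k _ => by
      have := (integrable_natPow_mul_exp_neg_mul_sq (mul_pos pi_pos pi_pos) k).ofReal (𝕜 := ℂ)
      refine this.congr (Filter.Eventually.of_forall fun x => ?_)
      simp) le_top
  have h1 := congrFun (iteratedDeriv_ofReal_comp contDiff_exp_neg_sq n) z
  rw [← h1, key, iteratedDeriv_const_mul_field, h, Real.fourier_real_eq_integral_exp_smul]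
  simp only [smul_eq_mul]

theorem exp_taylor_mul_gaussian_hasSum (q x : ℝ) :
    HasSum (fun j : ℕ => (4 * π ^ 2 * q * x ^ 2) ^ j / (j.factorial : ℝ) *
      Real.exp (-(π * π) * x ^ 2)) (Real.exp (-(π * (π * (1 - 4 * q))) * x ^ 2)) := by
  have h := (NormedSpace.expSeries_div_hasSum_exp (4 * π ^ 2 * q * x ^ 2)).mul_right
    (Real.exp (-(π * π) * x ^ 2))
  rw [← congrFun Real.exp_eq_exp_ℝ, ← Real.exp_add] at h
  convert! h using 2
  ring_nf

theorem hasSum_integral_mul_exp_taylor_mul_gaussian {q : ℝ} (hq : 0 ≤ q) (hq' : 4 * q < 1)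
    {φ : ℝ → ℂ} (hφ : Continuous φ) (hφ1 : ∀ x, ‖φ x‖ = 1) :
    HasSum (fun j : ℕ => ∫ x : ℝ, φ x * (((4 * π ^ 2 * q * x ^ 2) ^ j / (j.factorial : ℝ) *
      Real.exp (-(π * π) * x ^ 2) : ℝ) : ℂ))
      (∫ x : ℝ, φ x * (Real.exp (-(π * (π * (1 - 4 * q))) * x ^ 2) : ℂ)) := by
  refine hasSum_integral_of_dominated_convergence
    (fun j x => (4 * π ^ 2 * q * x ^ 2) ^ j / (j.factorial : ℝ) * Real.exp (-(π * π) * x ^ 2))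
    (fun j => ?_) (fun j => ?_) ?_ ?_ ?_
  · exact Continuous.aestronglyMeasurable (by fun_prop)
  · refine Filter.Eventually.of_forall fun x => ?_
    rw [norm_mul, hφ1, one_mul, Complex.norm_real, Real.norm_of_nonneg (by positivity)]
  · exact Filter.Eventually.of_forall fun x => (exp_taylor_mul_gaussian_hasSum q x).summable
  · simp_rw [fun x => (exp_taylor_mul_gaussian_hasSum q x).tsum_eq]
    exact integrable_exp_neg_mul_sq (mul_pos pi_pos (mul_pos pi_pos (by linarith)))
  · refine Filter.Eventually.of_forall fun x => ?_
    exact (Complex.hasSum_ofReal.mpr (exp_taylor_mul_gaussian_hasSum q x)).mul_left _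

theorem ofReal_even_iteratedDeriv_exp_neg_sq (q : ℝ) (j : ℕ) (z : ℝ) :
    (((-q) ^ j / (j.factorial : ℝ) *
        iteratedDeriv (2 * j) (fun t : ℝ => Real.exp (-t ^ 2)) z : ℝ) : ℂ) =
      ((√π : ℝ) : ℂ) * ∫ x : ℝ, Complex.exp (((-2 * π * x * z : ℝ) : ℂ) * Complex.I) *
        (((4 * π ^ 2 * q * x ^ 2) ^ j / (j.factorial : ℝ) *
          Real.exp (-(π * π) * x ^ 2) : ℝ) : ℂ) := by
  rw [Complex.ofReal_mul, ofReal_iteratedDeriv_exp_neg_sq, mul_left_comm, ← integral_const_mul]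
  congr 2
  funext x
  have e : (-2 * (π : ℂ) * Complex.I * x) ^ (2 * j) = (-(4 * π ^ 2 * x ^ 2)) ^ j := by
    rw [pow_mul]
    congr 1
    linear_combination (4 * (π : ℂ) ^ 2 * x ^ 2) * Complex.I_sq
  have e' : (4 * (π : ℂ) ^ 2 * q * x ^ 2) ^ j = (-(q : ℂ)) ^ j * (-(4 * π ^ 2 * x ^ 2)) ^ j := by
    rw [← mul_pow]
    congr 1
    ring
  rw [e]
  push_cast
  rw [e']
  ring

theorem hasSum_even_iteratedDeriv_exp_neg_sq {q : ℝ} (hq : 0 ≤ q) (hq' : 4 * q < 1) (z : ℝ) :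
    HasSum (fun j : ℕ => (-q) ^ j / (j.factorial : ℝ) *
        iteratedDeriv (2 * j) (fun t : ℝ => Real.exp (-t ^ 2)) z)
      (1 / √(1 - 4 * q) * Real.exp (-z ^ 2 / (1 - 4 * q))) := by
  have hpos : 0 < 1 - 4 * q := by linarith
  rw [← Complex.hasSum_ofReal]
  simp_rw [ofReal_even_iteratedDeriv_exp_neg_sq]
  have h := (hasSum_integral_mul_exp_taylor_mul_gaussian hq hq'
    (φ := fun x => Complex.exp (((-2 * π * x * z : ℝ) : ℂ) * Complex.I)) (by fun_prop)
    (fun x => Complex.norm_exp_ofReal_mul_I _)).mul_left ((√π : ℝ) : ℂ)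
  have hF := fourier_gaussian_real (mul_pos pi_pos hpos) z
  rw [Real.fourier_real_eq_integral_exp_smul] at hF
  simp only [smul_eq_mul] at hF
  rw [hF, ← Complex.ofReal_mul] at h
  convert! h using 2
  have hs : √π ≠ 0 := (Real.sqrt_pos.mpr pi_pos).ne'
  have hs' : √(1 - 4 * q) ≠ 0 := (Real.sqrt_pos.mpr hpos).ne'
  rw [Real.sqrt_mul pi_pos.le, ← mul_assoc]
  congr 1
  · field_simp
  · congr 1
    field_simp

theorem exists_summable_bound_even_iteratedDeriv_exp_neg_sq {q : ℝ} (hq : 0 ≤ q)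
    (hq' : 4 * q < 1) :
    ∃ b : ℕ → ℝ, Summable b ∧ ∀ j z, |(-q) ^ j / (j.factorial : ℝ) *
        iteratedDeriv (2 * j) (fun t : ℝ => Real.exp (-t ^ 2)) z| ≤ b j := by
  refine ⟨fun j => √π * ∫ x : ℝ, (4 * π ^ 2 * q * x ^ 2) ^ j / (j.factorial : ℝ) *
      Real.exp (-(π * π) * x ^ 2), ?_, fun j z => ?_⟩
  · have h := (hasSum_integral_mul_exp_taylor_mul_gaussian hq hq' (φ := fun _ => 1)
      (by fun_prop) (by simp)).summable
    simp only [one_mul, integral_complex_ofReal] at h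
    exact (Complex.summable_ofReal.mp h).mul_left _
  · rw [← Real.norm_eq_abs, ← Complex.norm_real, ofReal_even_iteratedDeriv_exp_neg_sq, norm_mul,
      Complex.norm_real, Real.norm_of_nonneg (Real.sqrt_nonneg _)]
    refine mul_le_mul_of_nonneg_left ?_ (Real.sqrt_nonneg _)
    refine (norm_integral_le_integral_norm _).trans_eq ?_
    congr 1
    funext x
    rw [norm_mul, Complex.norm_exp_ofReal_mul_I, one_mul, Complex.norm_real,
      Real.norm_of_nonneg (by positivity)]

theorem hermiteH_even (j : ℕ) (z : ℝ) :
    hermiteH (2 * j) z =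
      Real.exp (z ^ 2) * iteratedDeriv (2 * j) (fun t : ℝ => Real.exp (-t ^ 2)) z := by
  simp [hermiteH, pow_mul]

theorem continuous_hermiteH (n : ℕ) : Continuous (hermiteH n) := by
  have h : Continuous (iteratedDeriv n fun t : ℝ => Real.exp (-t ^ 2)) :=
    contDiff_exp_neg_sq.continuous_iteratedDeriv n (mod_cast le_top)
  unfold hermiteH
  fun_prop

/-- The generating function of the even Hermite polynomials, at `-q` with `0 ≤ 4q < 1`. -/
theorem hasSum_hermiteH_even {q : ℝ} (hq : 0 ≤ q) (hq' : 4 * q < 1) (z : ℝ) :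
    HasSum (fun j : ℕ => (-q) ^ j / (j.factorial : ℝ) * hermiteH (2 * j) z)
      (1 / √(1 - 4 * q) * Real.exp (z ^ 2 - z ^ 2 / (1 - 4 * q))) := by
  have h := (hasSum_even_iteratedDeriv_exp_neg_sq hq hq' z).mul_left (Real.exp (z ^ 2))
  simp_rw [hermiteH_even]
  convert! h using 1
  · funext j
    ring
  · rw [sub_eq_add_neg (z ^ 2), Real.exp_add, neg_div]
    ring

theorem hasSum_integral_hermiteH_even_mul {f : ℝ → ℝ} (hf : Continuous f)
    (hsupp : HasCompactSupport f) {g : ℝ → ℝ} (hg : Continuous g) {q : ℝ} (hq : 0 ≤ q)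
    (hq' : 4 * q < 1) :
    HasSum (fun j : ℕ => ∫ ξ : ℝ, (-q) ^ j / (j.factorial : ℝ) * hermiteH (2 * j) (g ξ) * f ξ)
      (∫ ξ : ℝ, 1 / √(1 - 4 * q) * Real.exp (g ξ ^ 2 - g ξ ^ 2 / (1 - 4 * q)) * f ξ) := by
  obtain ⟨b, hb, hbound⟩ := exists_summable_bound_even_iteratedDeriv_exp_neg_sq hq hq'
  refine hasSum_integral_of_dominated_convergence
    (fun j ξ => b j * (Real.exp (g ξ ^ 2) * |f ξ|)) (fun j => ?_) (fun j => ?_) ?_ ?_ ?_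
  · have := continuous_hermiteH (2 * j)
    exact Continuous.aestronglyMeasurable (by fun_prop)
  · refine Filter.Eventually.of_forall fun ξ => ?_
    rw [hermiteH_even, Real.norm_eq_abs, mul_left_comm, mul_comm (Real.exp _), mul_assoc, abs_mul,
      abs_mul (Real.exp _), Real.abs_exp]
    exact mul_le_mul_of_nonneg_right (hbound j _) (by positivity)
  · exact Filter.Eventually.of_forall fun ξ => hb.mul_right _
  · simp_rw [tsum_mul_right]
    refine Integrable.const_mul ?_ _
    exact Continuous.integrable_of_hasCompactSupport (by fun_prop)
      (HasCompactSupport.mul_left hsupp.abs)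
  · exact Filter.Eventually.of_forall fun ξ => (hasSum_hermiteH_even hq hq' (g ξ)).mul_right _

/-- Third Hermite-series form of the solution of the direct Cauchy problem for the
heat equation: with `u(τ,x)` the Poisson integral of a continuous, compactly
supported `f`, the series `(1/√π) ∑_j (1/(2√(τ+β)))^{2j+1} ((−1)^j β^j/j!) f_{2j}`
converges to `u(τ,x)`, where `f_{2j} = ∫ H_{2j}((x−ξ)/(2√β)) f(ξ) dξ`. -/
theorem heat_solution_even_hermite_series (f : ℝ → ℝ) (hf : Continuous f)
    (hsupp : HasCompactSupport f) (τ β : ℝ) (hτ : 0 < τ) (hβ : 0 < β)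
    (u : ℝ → ℝ)
    (hu : ∀ x : ℝ, u x =
      (1 / (2 * Real.sqrt (Real.pi * τ))) * ∫ ξ : ℝ, Real.exp (-(x - ξ) ^ 2 / (4 * τ)) * f ξ)
    (x : ℝ) :
    ∃ s : ℝ,
      HasSum
        (fun j : ℕ =>
          (1 / (2 * Real.sqrt (τ + β))) ^ (2 * j + 1) *
            ((-1 : ℝ) ^ j * β ^ j / (j.factorial : ℝ)) *
            ∫ ξ : ℝ, hermiteH (2 * j) ((x - ξ) / (2 * Real.sqrt β)) * f ξ)
        s ∧
      u x = (1 / Real.sqrt Real.pi) * s := by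
  have hτβ : 0 < τ + β := by linarith
  have hs : 0 < √(τ + β) := Real.sqrt_pos.mpr hτβ
  have hsq : √(τ + β) ^ 2 = τ + β := Real.sq_sqrt hτβ.le
  have h4 : 4 * (β / (4 * (τ + β))) < 1 := by
    rw [← mul_div_assoc, div_lt_one (by positivity)]
    linarith
  have h14 : 1 - 4 * (β / (4 * (τ + β))) = τ / (τ + β) := by
    field_simp
    ring
  have h := (hasSum_integral_hermiteH_even_mul hf hsupp
    (g := fun ξ => (x - ξ) / (2 * √β)) (by fun_prop)
    (q := β / (4 * (τ + β))) (by positivity) h4).mul_left (1 / (2 * √(τ + β)))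
  refine ⟨1 / (2 * √(τ + β)) * ∫ ξ : ℝ, 1 / √(1 - 4 * (β / (4 * (τ + β)))) *
    Real.exp (((x - ξ) / (2 * √β)) ^ 2 -
      ((x - ξ) / (2 * √β)) ^ 2 / (1 - 4 * (β / (4 * (τ + β))))) * f ξ, ?_, ?_⟩
  · convert! h using 1
    funext j
    rw [← integral_const_mul, ← integral_const_mul]
    congr 1
    funext ξ
    have e : (1 / (2 * √(τ + β))) ^ (2 * j + 1) * ((-1 : ℝ) ^ j * β ^ j) =
        1 / (2 * √(τ + β)) * (-(β / (4 * (τ + β)))) ^ j := by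
      rw [pow_succ, pow_mul, ← mul_pow, mul_right_comm, ← mul_pow, mul_comm]
      congr 2
      rw [div_pow, mul_pow, hsq]
      ring
    linear_combination (hermiteH (2 * j) ((x - ξ) / (2 * √β)) * f ξ / (j.factorial : ℝ)) * e
  · rw [hu, h14, ← integral_const_mul, ← integral_const_mul, ← integral_const_mul]
    congr 1
    funext ξ
    have e1 : ((x - ξ) / (2 * √β)) ^ 2 - ((x - ξ) / (2 * √β)) ^ 2 / (τ / (τ + β)) =
        -(x - ξ) ^ 2 / (4 * τ) := by
      rw [div_pow, mul_pow, Real.sq_sqrt hβ.le]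
      field_simp
      ring
    rw [e1, Real.sqrt_div hτ.le, Real.sqrt_mul pi_pos.le]
    have : 0 < √τ := Real.sqrt_pos.mpr hτ
    field_simp
end

section
/- Let f : ℝ → ℝ be infinitely differentiable with compact support, let τ > 0 and β > 0, and let u(τ,ξ) = (1/(2√(πτ))) ∫_ℝ exp(−(ξ−η)²/(4τ)) f(η) dη. Then for every real x the series (1/√π) · ∑_{j=0}^∞ (1/(2√β)^{2j+1}) · ((−1)^j (τ+β)^j / j!) · u_{2j} converges, where u_{2j} = ∫_ℝ H_{2j}((x−ξ)/(2√(τ+β))) u(τ,ξ) dξ, and its sum equals f(x). -/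
open Real MeasureTheory

open Polynomial in
/-- The physicists' Hermite polynomials as elements of `ℝ[X]`. -/
noncomputable def physHermite : ℕ → ℝ[X]
  | 0 => 1
  | n + 1 => C 2 * X * physHermite n - derivative (physHermite n)

open Polynomial in
theorem derivative_physHermite_succ (n : ℕ) :
    derivative (physHermite (n + 1)) = C (2 * ((n : ℝ) + 1)) * physHermite n := by
  induction n with
  | zero => simp [physHermite]
  | succ n ih =>
    rw [physHermite, derivative_sub, ih]
    simp only [derivative_mul, derivative_C, derivative_X, ih]
    rw [physHermite]
    push_cast
    simp only [map_mul, map_add, map_one]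
    ring

theorem hasDerivAt_physHermite_mul_exp (n : ℕ) (z : ℝ) :
    HasDerivAt (fun t : ℝ => (-1) ^ n * (physHermite n).eval t * Real.exp (-t ^ 2))
      ((-1) ^ (n + 1) * (physHermite (n + 1)).eval z * Real.exp (-z ^ 2)) z := by
  have h1 := ((physHermite n).hasDerivAt z).const_mul ((-1 : ℝ) ^ n)
  have h2 : HasDerivAt (fun t : ℝ => Real.exp (-t ^ 2)) (Real.exp (-z ^ 2) * -(2 * z)) z := by
    simpa using ((hasDerivAt_pow 2 z).neg).exp
  refine (h1.mul h2).congr_deriv ?_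
  simp only [physHermite, Polynomial.eval_sub, Polynomial.eval_mul, Polynomial.eval_C,
    Polynomial.eval_X]
  ring

theorem iteratedDeriv_exp_neg_sq (n : ℕ) :
    iteratedDeriv n (fun t : ℝ => Real.exp (-t ^ 2)) =
      fun z => (-1) ^ n * (physHermite n).eval z * Real.exp (-z ^ 2) := by
  induction n with
  | zero => simp [physHermite]
  | succ n ih =>
    rw [iteratedDeriv_succ, ih]
    exact funext fun z => (hasDerivAt_physHermite_mul_exp n z).deriv

theorem iteratedDeriv_const_mul_ofReal_exp_neg_sq (c : ℂ) (n : ℕ) :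
    iteratedDeriv n (fun t : ℝ => c * ((Real.exp (-t ^ 2) : ℝ) : ℂ)) =
      fun z => c * (((-1) ^ n * (physHermite n).eval z * Real.exp (-z ^ 2) : ℝ) : ℂ) := by
  induction n with
  | zero => simp [physHermite]
  | succ n ih =>
    rw [iteratedDeriv_succ, ih]
    exact funext fun z =>
      ((hasDerivAt_physHermite_mul_exp n z).ofReal_comp.const_mul c).deriv

theorem hermiteH_eq_eval (n : ℕ) (z : ℝ) : hermiteH n z = (physHermite n).eval z := by
  have hsq : ((-1 : ℝ) ^ n) * (-1) ^ n = 1 := by rw [← mul_pow]; simp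
  have hexp : Real.exp (z ^ 2) * Real.exp (-z ^ 2) = 1 := by rw [← Real.exp_add]; simp
  rw [hermiteH, iteratedDeriv_exp_neg_sq]
  linear_combination (physHermite n).eval z * (Real.exp (z ^ 2) * Real.exp (-z ^ 2)) * hsq +
    (physHermite n).eval z * hexp

theorem integrable_pow_mul_exp_neg_mul_sq {b : ℝ} (hb : 0 < b) (n : ℕ) :
    Integrable fun s : ℝ => s ^ n * Real.exp (-b * s ^ 2) := by
  simpa using integrable_rpow_mul_exp_neg_mul_sq hb
    (neg_one_lt_zero.trans_le (Nat.cast_nonneg n) : (-1 : ℝ) < n)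

theorem integrable_polynomial_mul_exp_neg_mul_sq {b : ℝ} (hb : 0 < b) (p : Polynomial ℝ) :
    Integrable fun s : ℝ => p.eval s * Real.exp (-b * s ^ 2) := by
  simp only [Polynomial.eval_eq_sum_range, Finset.sum_mul, mul_assoc]
  exact integrable_finsetSum _ fun i _ => (integrable_pow_mul_exp_neg_mul_sq hb i).const_mul _

/-- Gaussian integration by parts for polynomials. -/
theorem integral_mul_polynomial_mul_exp_neg_mul_sq {b : ℝ} (hb : 0 < b) (p : Polynomial ℝ) :
    2 * b * ∫ s : ℝ, s * p.eval s * Real.exp (-b * s ^ 2) =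
      ∫ s : ℝ, p.derivative.eval s * Real.exp (-b * s ^ 2) := by
  have hd (s : ℝ) : HasDerivAt (fun s : ℝ => p.eval s * Real.exp (-b * s ^ 2))
      (p.derivative.eval s * Real.exp (-b * s ^ 2) -
        2 * b * (s * p.eval s * Real.exp (-b * s ^ 2))) s := by
    have h2 : HasDerivAt (fun t : ℝ => Real.exp (-b * t ^ 2))
        (Real.exp (-b * s ^ 2) * (-b * (2 * s))) s := by
      simpa using ((hasDerivAt_pow 2 s).const_mul (-b)).exp
    refine ((p.hasDerivAt s).mul h2).congr_deriv ?_
    ring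
  have i1 := integrable_polynomial_mul_exp_neg_mul_sq hb p.derivative
  have i2 : Integrable fun s : ℝ => 2 * b * (s * p.eval s * Real.exp (-b * s ^ 2)) := by
    have h := (integrable_polynomial_mul_exp_neg_mul_sq hb (Polynomial.X * p)).const_mul (2 * b)
    simpa only [Polynomial.eval_mul, Polynomial.eval_X] using h
  have h := integral_eq_zero_of_hasDerivAt_of_integrable hd (i1.sub i2)
    (integrable_polynomial_mul_exp_neg_mul_sq hb p)
  rw [integral_sub i1 i2, integral_const_mul] at h
  linarith

theorem integral_physHermite_succ_succ {b : ℝ} (hb : 0 < b) (c z : ℝ) (n : ℕ) :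
    ∫ s : ℝ, (physHermite (n + 2)).eval (z + c * s) * Real.exp (-b * s ^ 2) =
      2 * z * (∫ s : ℝ, (physHermite (n + 1)).eval (z + c * s) * Real.exp (-b * s ^ 2)) -
      2 * (n + 1) * (1 - c ^ 2 / b) *
        ∫ s : ℝ, (physHermite n).eval (z + c * s) * Real.exp (-b * s ^ 2) := by
  set L : Polynomial ℝ := Polynomial.C z + Polynomial.C c * Polynomial.X with hL
  have hint (n : ℕ) :
      Integrable fun s : ℝ => (physHermite n).eval (z + c * s) * Real.exp (-b * s ^ 2) := by
    simpa [hL] using integrable_polynomial_mul_exp_neg_mul_sq hb ((physHermite n).comp L)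
  have hint' : Integrable fun s : ℝ =>
      s * (physHermite (n + 1)).eval (z + c * s) * Real.exp (-b * s ^ 2) := by
    have h := integrable_polynomial_mul_exp_neg_mul_sq hb
      (Polynomial.X * (physHermite (n + 1)).comp L)
    simpa only [hL, Polynomial.eval_mul, Polynomial.eval_add, Polynomial.eval_comp,
      Polynomial.eval_C, Polynomial.eval_X] using h
  have hparts := integral_mul_polynomial_mul_exp_neg_mul_sq hb ((physHermite (n + 1)).comp L)
  have hder (s : ℝ) : ((physHermite (n + 1)).comp L).derivative.eval s =
      c * (2 * (n + 1)) * (physHermite n).eval (z + c * s) := by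
    simp [Polynomial.derivative_comp, derivative_physHermite_succ, hL]
    ring
  simp only [hder, Polynomial.eval_comp, mul_assoc (c * (2 * ((n : ℝ) + 1))),
    integral_const_mul] at hparts
  simp only [hL, Polynomial.eval_add, Polynomial.eval_mul, Polynomial.eval_C,
    Polynomial.eval_X] at hparts
  have hrec (s : ℝ) : (physHermite (n + 2)).eval (z + c * s) * Real.exp (-b * s ^ 2) =
      2 * z * ((physHermite (n + 1)).eval (z + c * s) * Real.exp (-b * s ^ 2)) +
      2 * c * (s * (physHermite (n + 1)).eval (z + c * s) * Real.exp (-b * s ^ 2)) -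
      2 * (n + 1) * ((physHermite n).eval (z + c * s) * Real.exp (-b * s ^ 2)) := by
    rw [physHermite, derivative_physHermite_succ]
    simp
    ring
  simp only [hrec]
  have i1 := (hint (n + 1)).const_mul (2 * z)
  have i2 := hint'.const_mul (2 * c)
  rw [integral_sub (by exact i1.add i2) ((hint n).const_mul (2 * (n + 1))), integral_add i1 i2]
  have hI : ∫ s : ℝ, s * (physHermite (n + 1)).eval (z + c * s) * Real.exp (-b * s ^ 2) =
      c * (2 * (n + 1)) / (2 * b) *
        ∫ s : ℝ, (physHermite n).eval (z + c * s) * Real.exp (-b * s ^ 2) := by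
    rw [div_mul_eq_mul_div, ← hparts, mul_div_cancel_left₀ _ (by positivity)]
  simp only [integral_const_mul, hI]
  ring

/-- Averaging a Hermite polynomial against a Gaussian rescales it. -/
theorem integral_physHermite_mul_exp_neg_mul_sq {b : ℝ} (hb : 0 < b) (c z l : ℝ) (hl : l ≠ 0)
    (hlc : l ^ 2 = 1 - c ^ 2 / b) (n : ℕ) :
    ∫ s : ℝ, (physHermite n).eval (z + c * s) * Real.exp (-b * s ^ 2) =
      √(π / b) * (l ^ n * (physHermite n).eval (z / l)) := by
  induction n using Nat.twoStepInduction with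
  | zero => simpa [physHermite] using integral_gaussian b
  | one =>
    have h0 := integral_mul_polynomial_mul_exp_neg_mul_sq hb 1
    have i1 : Integrable fun s : ℝ => s * Real.exp (-b * s ^ 2) :=
      integrable_mul_exp_neg_mul_sq hb
    have h1 : ∫ s : ℝ, s * Real.exp (-b * s ^ 2) = 0 := by simpa [hb.ne'] using h0
    have hs (s : ℝ) : (physHermite 1).eval (z + c * s) * Real.exp (-b * s ^ 2) =
        2 * z * Real.exp (-b * s ^ 2) + 2 * c * (s * Real.exp (-b * s ^ 2)) := by
      simp [physHermite]
      ring
    simp only [hs]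
    rw [integral_add ((integrable_exp_neg_mul_sq hb).const_mul _) (i1.const_mul _),
      integral_const_mul, integral_const_mul, h1, integral_gaussian]
    simp [physHermite]
    field_simp
  | more n h0 h1 =>
    rw [integral_physHermite_succ_succ hb, h0, h1, ← hlc]
    have hrec : (physHermite (n + 2)).eval (z / l) =
        2 * (z / l) * (physHermite (n + 1)).eval (z / l) -
          2 * (n + 1) * (physHermite n).eval (z / l) := by
      rw [physHermite, derivative_physHermite_succ]
      simp
    rw [hrec]
    field_simp
    ring

/-- The Hermite expansion at the origin of a smooth compactly supported function. -/
theorem hasSum_integral_hermite_mul_exp_mul (G : ℝ → ℝ) (hG : ContDiff ℝ (⊤ : ℕ∞) G)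
    (hsupp : HasCompactSupport G) :
    HasSum (fun j : ℕ => (-1 : ℝ) ^ j / (4 ^ j * (j.factorial : ℝ)) *
      ∫ y : ℝ, (physHermite (2 * j)).eval y * Real.exp (-y ^ 2) * G y) (√π * G 0) := by
  have hGs : HasCompactSupport fun y => (G y : ℂ) :=
    hsupp.comp_left (g := Complex.ofReal) Complex.ofReal_zero
  have hGc : ContDiff ℝ (⊤ : ℕ∞) fun y => (G y : ℂ) := Complex.ofRealCLM.contDiff.comp hG
  set g : SchwartzMap ℝ ℂ := hGs.toSchwartzMap hGc
  have hgG : (g : ℝ → ℂ) = fun y => (G y : ℂ) := rfl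
  set κ : ℝ → ℂ := fun t => Complex.exp (-π * (π : ℂ) * t ^ 2) with hκ
  have hκr (t : ℝ) : κ t = (Real.exp (-(π ^ 2) * t ^ 2) : ℝ) := by
    simp only [hκ]; push_cast; congr 1; ring
  have hFκ : FourierTransform.fourier κ = fun t : ℝ =>
      (1 / (π : ℂ) ^ (1 / 2 : ℂ)) * ((Real.exp (-t ^ 2) : ℝ) : ℂ) := by
    have := fourier_gaussian_pi (b := (π : ℂ)) (by simpa using Real.pi_pos)
    rw [hκ, this]
    funext t
    have : (π : ℂ) ≠ 0 := by exact_mod_cast Real.pi_ne_zero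
    push_cast
    rw [neg_div, div_self this, neg_one_mul]
  have hsq : (π : ℂ) ^ (1 / 2 : ℂ) = (√π : ℝ) := by
    rw [Real.sqrt_eq_rpow, Complex.ofReal_cpow Real.pi_pos.le]; simp
  have hκint (n : ℕ) : Integrable fun t : ℝ => t ^ n • κ t := by
    have := (integrable_pow_mul_exp_neg_mul_sq (b := π ^ 2) (by positivity) n).ofReal (𝕜 := ℂ)
    refine this.congr (Filter.Eventually.of_forall fun t => ?_)
    simp [hκr, Complex.real_smul]
  have hterm (j : ℕ) : ((∫ y : ℝ, (physHermite (2 * j)).eval y * Real.exp (-y ^ 2) * G y : ℝ) : ℂ)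
      = (√π : ℝ) * ∫ t : ℝ, (-2 * π * Complex.I * t) ^ (2 * j) * κ t *
        FourierTransform.fourier g t := by
    have hd := Real.iteratedDeriv_fourier (f := κ) (N := ⊤) (n := 2 * j)
      (fun n _ => hκint n) le_top
    rw [hFκ, iteratedDeriv_const_mul_ofReal_exp_neg_sq] at hd
    have hint : Integrable fun t : ℝ => (-2 * π * Complex.I * t) ^ (2 * j) • κ t := by
      refine ((hκint (2 * j)).const_mul ((-2 * π * Complex.I) ^ (2 * j))).congr
        (Filter.Eventually.of_forall fun t => ?_)
      simp only [smul_eq_mul, Complex.real_smul, mul_pow]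
      push_cast
      ring
    have hpar := VectorFourier.integral_fourierIntegral_smul_eq_flip (L := innerₗ ℝ)
      Real.continuous_fourierChar continuous_inner hint (g.integrable (μ := volume))
    have hpar' : ∫ y : ℝ, FourierTransform.fourier
        (fun t : ℝ => (-2 * π * Complex.I * t) ^ (2 * j) • κ t) y * (G y : ℂ) =
        ∫ t : ℝ, (-2 * π * Complex.I * t) ^ (2 * j) * κ t * FourierTransform.fourier g t := by
      simpa using! hpar
    rw [← hpar', ← hd, ← integral_const_mul, ← integral_complex_ofReal]
    congr 1
    funext y
    have : ((√π : ℝ) : ℂ) ≠ 0 := by exact_mod_cast (Real.sqrt_pos.2 Real.pi_pos).ne'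
    rw [hsq]
    push_cast
    field_simp
    simp [pow_mul]
  have hFint : Integrable (FourierTransform.fourier g : SchwartzMap ℝ ℂ) :=
    (FourierTransform.fourier g).integrable
  have hF0 : ∫ t : ℝ, FourierTransform.fourier g t = (G 0 : ℂ) := by
    have h1 : FourierTransform.fourierInv (FourierTransform.fourier g) = g :=
      FourierTransform.fourierInv_fourier_eq g
    have h2 := congrArg (fun h : SchwartzMap ℝ ℂ => h 0) h1
    simp only [SchwartzMap.fourierInv_coe, Real.fourierInv_eq] at h2
    simpa [hgG] using h2
  have hexp (t : ℝ) : HasSum (fun j : ℕ => (π ^ 2 * t ^ 2) ^ j / (j.factorial : ℝ) *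
      Real.exp (-(π ^ 2) * t ^ 2)) 1 := by
    have := (NormedSpace.expSeries_div_hasSum_exp (π ^ 2 * t ^ 2)).mul_right
      (Real.exp (-(π ^ 2) * t ^ 2))
    rwa [← Real.exp_eq_exp_ℝ, ← Real.exp_add, neg_mul, add_neg_cancel, Real.exp_zero,
      ← neg_mul] at this
  have key : HasSum (fun j : ℕ => ∫ t : ℝ,
      (((π ^ 2 * t ^ 2) ^ j / (j.factorial : ℝ) * Real.exp (-(π ^ 2) * t ^ 2) : ℝ) : ℂ) *
        FourierTransform.fourier g t) (∫ t : ℝ, FourierTransform.fourier g t) := by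
    refine hasSum_integral_of_dominated_convergence
      (fun j t => (π ^ 2 * t ^ 2) ^ j / (j.factorial : ℝ) * Real.exp (-(π ^ 2) * t ^ 2) *
        ‖FourierTransform.fourier g t‖) ?_ ?_ ?_ ?_ ?_
    · intro j
      refine AEStronglyMeasurable.mul ?_ hFint.aestronglyMeasurable
      exact (by fun_prop : Continuous _).aestronglyMeasurable
    · refine fun j => Filter.Eventually.of_forall fun t => ?_
      rw [norm_mul, Complex.norm_real, Real.norm_of_nonneg (by positivity)]
    · exact Filter.Eventually.of_forall fun t => ((hexp t).mul_right _).summable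
    · refine hFint.norm.congr (Filter.Eventually.of_forall fun t => ?_)
      simpa using ((hexp t).mul_right ‖FourierTransform.fourier g t‖).tsum_eq.symm
    · refine Filter.Eventually.of_forall fun t => ?_
      simpa using ((Complex.hasSum_ofReal.2 (hexp t)).mul_right (FourierTransform.fourier g t))
  rw [← Complex.hasSum_ofReal, Complex.ofReal_mul, ← hF0]
  refine (key.mul_left ((√π : ℝ) : ℂ)).congr_fun ?_
  · intro j
    rw [Complex.ofReal_mul, hterm, mul_left_comm, ← integral_const_mul]
    congr 2
    funext t
    have hI : (-2 * π * Complex.I * t) ^ (2 * j) = (-1) ^ j * 4 ^ j * ((π : ℂ) ^ 2 * t ^ 2) ^ j := by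
      rw [pow_mul, ← mul_pow, ← mul_pow]
      congr 1
      linear_combination (4 * (π : ℂ) ^ 2 * t ^ 2) * Complex.I_sq
    have hone : ((-1 : ℂ) ^ j) * (-1) ^ j = 1 := by rw [← mul_pow]; simp
    rw [hI, hκr]
    push_cast
    linear_combination ((π : ℂ) ^ 2 * t ^ 2) ^ j / j.factorial *
      Complex.exp (-(π : ℂ) ^ 2 * t ^ 2) * FourierTransform.fourier g t *
      (hone * (4 ^ j / 4 ^ j) + div_self (pow_ne_zero j (by norm_num : (4 : ℂ) ≠ 0)))

theorem integrable_polynomial_mul_heatKernel_mul {τ : ℝ} (hτ : 0 < τ) {f : ℝ → ℝ}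
    (hf : Continuous f) (hsupp : HasCompactSupport f) (q : Polynomial ℝ) :
    Integrable (fun p : ℝ × ℝ =>
      q.eval p.1 * (Real.exp (-(p.1 - p.2) ^ 2 / (4 * τ)) * f p.2)) (volume.prod volume) := by
  have h1 := (integrable_polynomial_mul_exp_neg_mul_sq (b := 1 / (8 * τ)) (by positivity) q).norm
  have h2 : Integrable fun η : ℝ => Real.exp (η ^ 2 / (4 * τ)) * f η :=
    (by fun_prop : Continuous fun η : ℝ =>
      Real.exp (η ^ 2 / (4 * τ)) * f η).integrable_of_hasCompactSupport hsupp.mul_left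
  refine (h1.mul_prod h2.norm).mono' (by fun_prop) (Filter.Eventually.of_forall fun p => ?_)
  simp only [norm_mul, Real.norm_eq_abs, Real.abs_exp]
  have hexp : Real.exp (-(p.1 - p.2) ^ 2 / (4 * τ)) ≤
      Real.exp (-(1 / (8 * τ)) * p.1 ^ 2) * Real.exp (p.2 ^ 2 / (4 * τ)) := by
    rw [← Real.exp_add, Real.exp_le_exp]
    have : -(1 / (8 * τ)) * p.1 ^ 2 + p.2 ^ 2 / (4 * τ) - -(p.1 - p.2) ^ 2 / (4 * τ) =
        (p.1 - 2 * p.2) ^ 2 / (8 * τ) := by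
      field_simp
      ring
    have : 0 ≤ (p.1 - 2 * p.2) ^ 2 / (8 * τ) := by positivity
    linarith
  calc |q.eval p.1| * (Real.exp (-(p.1 - p.2) ^ 2 / (4 * τ)) * |f p.2|)
      ≤ |q.eval p.1| * (Real.exp (-(1 / (8 * τ)) * p.1 ^ 2) * Real.exp (p.2 ^ 2 / (4 * τ)) *
          |f p.2|) := by gcongr
    _ = _ := by ring

/-- Even Hermite polynomials are rescaled by convolution with the heat kernel. -/
theorem integral_physHermite_mul_heatKernel {τ β : ℝ} (hτ : 0 < τ) (hβ : 0 < β) (x η : ℝ)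
    (j : ℕ) :
    ∫ ξ : ℝ, (physHermite (2 * j)).eval ((x - ξ) / (2 * √(τ + β))) *
        Real.exp (-(ξ - η) ^ 2 / (4 * τ)) =
      2 * √(π * τ) * ((β / (τ + β)) ^ j * (physHermite (2 * j)).eval ((x - η) / (2 * √β))) := by
  have ha : 0 < τ + β := by positivity
  have hl : √(β / (τ + β)) ^ 2 = β / (τ + β) := Real.sq_sqrt (by positivity)
  have hl0 : √(β / (τ + β)) ≠ 0 := (Real.sqrt_pos.2 (by positivity)).ne'
  have h := integral_physHermite_mul_exp_neg_mul_sq (b := 1 / (4 * τ)) (by positivity)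
    (-1 / (2 * √(τ + β))) ((x - η) / (2 * √(τ + β))) _ hl0
    (by rw [hl, div_pow, mul_pow, Real.sq_sqrt ha.le]; field_simp; ring) (2 * j)
  rw [pow_mul, hl, Real.sqrt_div hβ.le] at h
  have hz : (x - η) / (2 * √(τ + β)) / (√β / √(τ + β)) = (x - η) / (2 * √β) := by
    have := (Real.sqrt_pos.2 hβ).ne'
    have := (Real.sqrt_pos.2 ha).ne'
    field_simp
  have hs : √(π / (1 / (4 * τ))) = 2 * √(π * τ) := by
    rw [show π / (1 / (4 * τ)) = 2 ^ 2 * (π * τ) by field_simp; ring,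
      Real.sqrt_mul (by positivity), Real.sqrt_sq (by positivity)]
  rw [hz, hs] at h
  rw [← h, ← integral_add_right_eq_self _ η]
  congr 1
  funext s
  congr 2
  · ring
  · ring

theorem integral_physHermite_mul_heat {f : ℝ → ℝ} (hf : Continuous f)
    (hsupp : HasCompactSupport f) {τ β : ℝ} (hτ : 0 < τ) (hβ : 0 < β) (x : ℝ) (j : ℕ) :
    ∫ ξ : ℝ, (physHermite (2 * j)).eval ((x - ξ) / (2 * √(τ + β))) *
        (1 / (2 * √(π * τ)) * ∫ η : ℝ, Real.exp (-(ξ - η) ^ 2 / (4 * τ)) * f η) =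
      (β / (τ + β)) ^ j * ∫ η : ℝ, (physHermite (2 * j)).eval ((x - η) / (2 * √β)) * f η := by
  have hint := integrable_polynomial_mul_heatKernel_mul hτ hf hsupp ((physHermite (2 * j)).comp
    (Polynomial.C (1 / (2 * √(τ + β))) * (Polynomial.C x - Polynomial.X)))
  simp only [Polynomial.eval_comp, Polynomial.eval_mul, Polynomial.eval_C, Polynomial.eval_sub,
    Polynomial.eval_X, one_div_mul_eq_div] at hint
  have hc : 0 < 2 * √(π * τ) := by have := Real.pi_pos; positivity
  simp only [mul_left_comm _ (1 / (2 * √(π * τ))), ← integral_const_mul]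
  simp only [integral_const_mul (1 / (2 * √(π * τ)))]
  rw [integral_integral_swap hint, ← integral_const_mul]
  congr 1
  funext η
  simp only [← mul_assoc]
  rw [integral_mul_const, integral_physHermite_mul_heatKernel hτ hβ]
  field_simp

theorem integral_comp_sub_div {k : ℝ} (hk : 0 < k) (p f : ℝ → ℝ) (x : ℝ) :
    ∫ η : ℝ, p ((x - η) / k) * f η = k * ∫ y : ℝ, p y * f (x - k * y) := by
  have h1 := integral_sub_left_eq_self (fun t : ℝ => p (t / k) * f (x - k * (t / k))) volume x
  have h2 := Measure.integral_comp_div (fun y : ℝ => p y * f (x - k * y)) k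
  rw [h2, abs_of_pos hk, smul_eq_mul] at h1
  rw [← h1]
  congr 1
  funext η
  congr 2
  field_simp
  ring

/-- Third Hermite-series reconstruction formula for the inverse Cauchy problem of
the heat equation: if `u(τ,·)` is the temperature field at time `τ` obtained from
a smooth, compactly supported initial field `f`, then for every `x` the series
`(1/√π) ∑_j (1/(2√β))^{2j+1} ((−1)^j (τ+β)^j/j!) u_{2j}` converges, with
`u_{2j} = ∫ H_{2j}((x−ξ)/(2√(τ+β))) u(τ,ξ) dξ`, and its sum is `f(x)`. -/
theorem inverse_heat_even_hermite_series (f : ℝ → ℝ) (hf : ContDiff ℝ (⊤ : ℕ∞) f)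
    (hsupp : HasCompactSupport f) (τ β : ℝ) (hτ : 0 < τ) (hβ : 0 < β)
    (u : ℝ → ℝ)
    (hu : ∀ ξ : ℝ, u ξ =
      (1 / (2 * Real.sqrt (Real.pi * τ))) * ∫ η : ℝ, Real.exp (-(ξ - η) ^ 2 / (4 * τ)) * f η)
    (x : ℝ) :
    ∃ s : ℝ,
      HasSum
        (fun j : ℕ =>
          (1 / (2 * Real.sqrt β)) ^ (2 * j + 1) *
            ((-1 : ℝ) ^ j * (τ + β) ^ j / (j.factorial : ℝ)) *
            ∫ ξ : ℝ, hermiteH (2 * j) ((x - ξ) / (2 * Real.sqrt (τ + β))) * u ξ)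
        s ∧
      f x = (1 / Real.sqrt Real.pi) * s := by
  set k : ℝ := 2 * √β with hk
  have hk0 : 0 < k := by positivity
  have hk2 : k ^ 2 = 4 * β := by rw [hk, mul_pow, Real.sq_sqrt hβ.le]; ring
  have hline : ContDiff ℝ (⊤ : ℕ∞) fun y : ℝ => x - k * y := by fun_prop
  have hG := hasSum_integral_hermite_mul_exp_mul
    (fun y => Real.exp (y ^ 2) * f (x - k * y))
    (ContDiff.mul (by fun_prop) (hf.comp hline))
    (HasCompactSupport.mul_left (hsupp.comp_homeomorph
      ((Homeomorph.mulLeft₀ k hk0.ne').trans (Homeomorph.subLeft x))))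
  refine ⟨_, hG.congr_fun fun j => ?_, ?_⟩
  · have hcancel (y : ℝ) : (physHermite (2 * j)).eval y * Real.exp (-y ^ 2) *
        (Real.exp (y ^ 2) * f (x - k * y)) = (physHermite (2 * j)).eval y * f (x - k * y) := by
      have : Real.exp (-y ^ 2) * Real.exp (y ^ 2) = 1 := by rw [← Real.exp_add]; simp
      linear_combination (physHermite (2 * j)).eval y * f (x - k * y) * this
    simp only [hcancel, hermiteH_eq_eval, hu]
    rw [integral_physHermite_mul_heat hf.continuous hsupp hτ hβ, ← hk,
      integral_comp_sub_div hk0 (fun y => (physHermite (2 * j)).eval y)]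
    have ha : (τ + β) ^ j ≠ 0 := by positivity
    rw [pow_succ, pow_mul, div_pow, div_pow, div_pow, hk2, mul_pow]
    field_simp
    simp
  · have : √π ≠ 0 := (Real.sqrt_pos.2 Real.pi_pos).ne'
    simp
    field_simp
end
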